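/- arXiv:math/0702067 — 2 statements merged into one kernel-verified Lean document; each statement's English description precedes it below -/
import Mathlib

section
/- If v ∈ Ḣ¹(Ω)² is divergence-free and θ ∈ Ḣ¹(Ω), then the duality pairing ⟨div(vθ), θ⟩ between Ḣ⁻¹ and Ḣ¹ vanishes: ⟨div(vθ), θ⟩ = 0. -/
open scoped BigOperators
open Filter

noncomputable section

/-- Frequencies on the 2D torus `[0,1]²`. -/
abbrev Freq : Type := ℤ × ℤ
/-- Fourier coefficients of a (complex-valued) function on the torus. -/
abbrev Coef : Type := Freq → ℂ
/-- Fourier coefficients of a vector field on the torus. -/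
abbrev VCoef : Type := Freq → ℂ × ℂ

/-- Euclidean norm `|k|` of a frequency. -/
def knorm (k : Freq) : ℝ := Real.sqrt ((k.1 : ℝ)^2 + (k.2 : ℝ)^2)

/-- Homogeneous Sobolev weight `(2π|k|)^{2s}` (vanishing at `k = 0` for `s ≠ 0`). -/
def wgt (s : ℝ) (k : Freq) : ℝ := (2 * Real.pi * knorm k) ^ (2 * s)

/-- Squared homogeneous Sobolev seminorm `‖·‖_{Ḣ^s}²` (Parseval). -/
def hSobSq (s : ℝ) (a : Coef) : ℝ := ∑' k : Freq, wgt s k * ‖a k‖ ^ 2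

/-- Homogeneous Sobolev seminorm `‖·‖_{Ḣ^s}`; `hSob 1 a = ‖∇a‖_{L²}`. -/
def hSob (s : ℝ) (a : Coef) : ℝ := Real.sqrt (hSobSq s a)

/-- Membership in the homogeneous Sobolev space `Ḣ^s`. -/
def MemhSob (s : ℝ) (a : Coef) : Prop := Summable fun k : Freq => wgt s k * ‖a k‖ ^ 2

/-- Squared inhomogeneous Sobolev norm `‖·‖_{H^s}²`. -/
def SobSq (s : ℝ) (a : Coef) : ℝ := ∑' k : Freq, (1 + (2 * Real.pi * knorm k)^2) ^ s * ‖a k‖ ^ 2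

/-- Inhomogeneous Sobolev norm `‖·‖_{H^s}`. -/
def Sob (s : ℝ) (a : Coef) : ℝ := Real.sqrt (SobSq s a)

/-- Membership in the Sobolev space `H^s`. -/
def MemSob (s : ℝ) (a : Coef) : Prop :=
  Summable fun k : Freq => (1 + (2 * Real.pi * knorm k)^2) ^ s * ‖a k‖ ^ 2

/-- Squared `L²` norm (Parseval). -/
def L2Sq (a : Coef) : ℝ := ∑' k : Freq, ‖a k‖ ^ 2

/-- `L²` norm. -/
def L2n (a : Coef) : ℝ := Real.sqrt (L2Sq a)

/-- Mean-zero condition `∫_Ω θ = 0`. -/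
def MeanZero (a : Coef) : Prop := a (0, 0) = 0

/-- The coefficients come from a real-valued function. -/
def RealCoef (a : Coef) : Prop := ∀ k : Freq, a (-k) = (starRingEnd ℂ) (a k)

/-- Norms for vector fields. -/
def vL2Sq (v : VCoef) : ℝ := ∑' k : Freq, (‖(v k).1‖ ^ 2 + ‖(v k).2‖ ^ 2)
def vhSobSq (s : ℝ) (v : VCoef) : ℝ := ∑' k : Freq, wgt s k * (‖(v k).1‖ ^ 2 + ‖(v k).2‖ ^ 2)
def vSobSq (s : ℝ) (v : VCoef) : ℝ :=
  ∑' k : Freq, (1 + (2 * Real.pi * knorm k)^2) ^ s * (‖(v k).1‖ ^ 2 + ‖(v k).2‖ ^ 2)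
def vSob (s : ℝ) (v : VCoef) : ℝ := Real.sqrt (vSobSq s v)
def vMemSob (s : ℝ) (v : VCoef) : Prop :=
  Summable fun k : Freq => (1 + (2 * Real.pi * knorm k)^2) ^ s * (‖(v k).1‖ ^ 2 + ‖(v k).2‖ ^ 2)
def vMemhSob (s : ℝ) (v : VCoef) : Prop :=
  Summable fun k : Freq => wgt s k * (‖(v k).1‖ ^ 2 + ‖(v k).2‖ ^ 2)
def vRealCoef (v : VCoef) : Prop :=
  ∀ k : Freq, (v (-k)).1 = (starRingEnd ℂ) ((v k).1) ∧ (v (-k)).2 = (starRingEnd ℂ) ((v k).2)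

/-- The velocity `v = ∇⊥(-Δ)^{-1/2}θ` in Fourier variables: `v̂(k) = i(-k₂,k₁)|k|⁻¹ θ̂(k)`. -/
def vel (a : Coef) : VCoef := fun k =>
  if k = (0, 0) then (0, 0)
  else (Complex.I * (-(k.2 : ℂ)) / ((knorm k : ℝ) : ℂ) * a k,
        Complex.I * ((k.1 : ℂ)) / ((knorm k : ℝ) : ℂ) * a k)

/-- Fourier coefficients of `div(vθ)`:
`(div(vθ))^(k) = 2πi (k₁ (v̂⋆θ̂)₁(k) + k₂ (v̂⋆θ̂)₂(k))`. -/
def divV (v : VCoef) (a : Coef) : Coef := fun k =>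
  (2 * Real.pi) * Complex.I *
    ((k.1 : ℂ) * ∑' j : Freq, (v j).1 * a (k - j) +
     (k.2 : ℂ) * ∑' j : Freq, (v j).2 * a (k - j))

/-- The (real) duality pairing `⟨b, φ⟩` between `Ḣ⁻¹` and `Ḣ¹` (Parseval). -/
def pairing (b φ : Coef) : ℝ := (∑' k : Freq, b k * (starRingEnd ℂ) (φ k)).re

/-- The Helmholtz operator `1 - α²Δ` in Fourier variables. -/
def Jop (α : ℝ) (a : Coef) : Coef := fun k =>
  (((1 + α^2 * (2 * Real.pi * knorm k)^2 : ℝ)) : ℂ) * a k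

/-- The inverse Helmholtz operator `(1 - α²Δ)^{-1}` in Fourier variables. -/
def Jinv (α : ℝ) (b : Coef) : Coef := fun k =>
  b k / (((1 + α^2 * (2 * Real.pi * knorm k)^2 : ℝ)) : ℂ)

/-- `θ : ℝ → Coef` is a (real, mean-zero) solution of the inviscid α-regularization of SQG:
`∂ₜ(1-α²Δ)θ + div(vθ) = 0`, `v = ∇⊥(-Δ)^{-1/2}θ`, read coefficientwise. -/
def SolvesRSQG (α : ℝ) (θ : ℝ → Coef) : Prop :=
  (∀ t : ℝ, MeanZero (θ t) ∧ RealCoef (θ t)) ∧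
  ∀ (k : Freq) (t : ℝ),
    HasDerivAt (fun s : ℝ => Jop α (θ s) k) (-(divV (vel (θ t)) (θ t) k)) t

/-- `θ` is a (real, mean-zero) solution of the SQG equation `∂ₜθ + div(vθ) = 0`,
`v = ∇⊥(-Δ)^{-1/2}θ`, on the time set `I`, read coefficientwise. -/
def SolvesSQGOn (I : Set ℝ) (θ : ℝ → Coef) : Prop :=
  (∀ t ∈ I, MeanZero (θ t) ∧ RealCoef (θ t)) ∧
  ∀ (k : Freq), ∀ t ∈ I,
    HasDerivAt (fun s : ℝ => θ s k) (-(divV (vel (θ t)) (θ t) k)) t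



lemma aux_W_ge (k : Freq) : 1 + (k.1 : ℝ)^2 + (k.2 : ℝ)^2 ≤ 1 + (2 * Real.pi * knorm k)^2 := by
  have h : knorm k ^ 2 = (k.1 : ℝ)^2 + (k.2 : ℝ)^2 := Real.sq_sqrt (by positivity)
  have hp := Real.pi_gt_three
  have : (2 * Real.pi * knorm k)^2 = (4 * Real.pi^2) * ((k.1 : ℝ)^2 + (k.2 : ℝ)^2) := by
    rw [← h]; ring
  rw [this]
  have h0 : 0 ≤ (k.1 : ℝ)^2 + (k.2 : ℝ)^2 := by positivity
  nlinarith [mul_nonneg (by nlinarith : (0:ℝ) ≤ 4 * Real.pi^2 - 1) h0]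

lemma aux_summable_int : Summable fun n : ℤ => 1 / (1 + (n : ℝ)^2) := by
  have h := (Real.summable_one_div_int_pow (p := 2)).2 (by norm_num)
  refine Summable.of_norm_bounded_eventually h ?_
  rw [Filter.eventually_cofinite]
  refine (Set.finite_singleton (0 : ℤ)).subset ?_
  intro n hn
  by_contra hne
  apply hn
  have hn0 : (n : ℝ) ≠ 0 := by exact_mod_cast hne
  rw [Real.norm_of_nonneg (by positivity)]
  apply one_div_le_one_div_of_le (by positivity)
  linarith

lemma aux_summable_W :
    Summable fun k : Freq => ((1 + (2 * Real.pi * knorm k)^2)⁻¹)^2 := by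
  have h := aux_summable_int.mul_of_nonneg aux_summable_int
    (fun n => by positivity) (fun n => by positivity)
  refine Summable.of_nonneg_of_le (fun k => by positivity) (fun k => ?_) h
  rw [one_div_mul_one_div, inv_pow, ← one_div]
  apply one_div_le_one_div_of_le (by positivity)
  have h1 := aux_W_ge k
  have h2 : (1 + (k.1 : ℝ)^2 + (k.2 : ℝ)^2)^2 ≤ (1 + (2 * Real.pi * knorm k)^2)^2 :=
    pow_le_pow_left₀ (by positivity) h1 2
  nlinarith [sq_nonneg (k.1 : ℝ), sq_nonneg (k.2 : ℝ),
    mul_nonneg (sq_nonneg (k.1 : ℝ)) (sq_nonneg (k.2 : ℝ)), sq_nonneg ((k.1 : ℝ)^2),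
    sq_nonneg ((k.2 : ℝ)^2)]

/-- The change of variables `(k, j) ↦ (j, k - j)`. -/
def auxShear : Freq × Freq ≃ Freq × Freq where
  toFun p := (p.2, p.1 - p.2)
  invFun q := (q.1 + q.2, q.1)
  left_inv p := by simp
  right_inv q := by simp

/-- The change of variables `(k, j) ↦ (k, k - j)`. -/
def auxRefl : Freq × Freq ≃ Freq × Freq where
  toFun p := (p.1, p.1 - p.2)
  invFun p := (p.1, p.1 - p.2)
  left_inv p := by simp
  right_inv q := by simp

/-- The change of variables `(k, j) ↦ (k - j, -j)`. -/
def auxSwap : Freq × Freq ≃ Freq × Freq where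
  toFun p := (p.1 - p.2, -p.2)
  invFun p := (p.1 - p.2, -p.2)
  left_inv p := by simp
  right_inv q := by simp

lemma aux_trilinear (u a g : Coef)
    (hu : Summable fun k : Freq => (1 + (2 * Real.pi * knorm k)^2) * ‖u k‖ ^ 2)
    (ha : Summable fun k : Freq => (1 + (2 * Real.pi * knorm k)^2) * ‖a k‖ ^ 2)
    (hg : Summable fun k : Freq => ‖g k‖ ^ 2) :
    Summable fun p : Freq × Freq => g p.1 * (u p.2 * a (p.1 - p.2)) := by
  have hX := (hu.mul_of_nonneg ha (fun n => by positivity) (fun n => by positivity))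
  have hX' := (auxShear.summable_iff).2 hX
  have hY := (hg.mul_of_nonneg aux_summable_W (fun n => by positivity) (fun n => by positivity))
  have hY' := (auxRefl.summable_iff).2 hY
  refine Summable.of_norm_bounded (hX'.add (hY.add hY')) ?_
  rintro ⟨k, j⟩
  simp only [Function.comp, auxShear, auxRefl, Equiv.coe_fn_mk, norm_mul]
  have hs : 0 < 1 + (2 * Real.pi * knorm j)^2 := by positivity
  have ht : 0 < 1 + (2 * Real.pi * knorm (k - j))^2 := by positivity
  generalize 1 + (2 * Real.pi * knorm j)^2 = s at *
  generalize 1 + (2 * Real.pi * knorm (k - j))^2 = t at *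
  generalize ‖u j‖ = x
  generalize ‖a (k - j)‖ = y
  generalize ‖g k‖ = z
  obtain ⟨σ, hσ, rfl⟩ : ∃ σ : ℝ, 0 < σ ∧ s = σ ^ 2 := ⟨√s, by positivity, by rw [Real.sq_sqrt hs.le]⟩
  obtain ⟨τ, hτ, rfl⟩ : ∃ τ : ℝ, 0 < τ ∧ t = τ ^ 2 := ⟨√t, by positivity, by rw [Real.sq_sqrt ht.le]⟩
  have e1 : z * (x * y) = (σ * x * (τ * y)) * (z * (σ⁻¹ * τ⁻¹)) := by
    field_simp
  have e2 : 2 * ((σ * x * (τ * y)) * (z * (σ⁻¹ * τ⁻¹)))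
      ≤ (σ * x * (τ * y))^2 + (z * (σ⁻¹ * τ⁻¹))^2 := by
    nlinarith [sq_nonneg ((σ * x * (τ * y)) - (z * (σ⁻¹ * τ⁻¹)))]
  have e3 : (z * (σ⁻¹ * τ⁻¹))^2 ≤ z^2 * ((σ^2)⁻¹)^2 + z^2 * ((τ^2)⁻¹)^2 := by
    have : (σ⁻¹ * τ⁻¹)^2 ≤ ((σ^2)⁻¹)^2 + ((τ^2)⁻¹)^2 := by
      rw [mul_pow, inv_pow, inv_pow]
      nlinarith [sq_nonneg ((σ^2)⁻¹ - (τ^2)⁻¹), sq_nonneg ((σ^2)⁻¹), sq_nonneg ((τ^2)⁻¹)]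
    rw [mul_pow, ← mul_add]
    exact mul_le_mul_of_nonneg_left this (sq_nonneg z)
  have e4 : 0 ≤ (σ * x * (τ * y))^2 := sq_nonneg _
  have e5 : 0 ≤ (z * (σ⁻¹ * τ⁻¹))^2 := sq_nonneg _
  have e6 : (σ * x * (τ * y))^2 = σ^2 * x^2 * (τ^2 * y^2) := by ring
  linarith

/-- If `v ∈ Ḣ¹(Ω)²` is divergence-free and `θ ∈ Ḣ¹(Ω)`, then the duality pairing
`⟨div(vθ), θ⟩` between `Ḣ⁻¹` and `Ḣ¹` vanishes. -/
theorem pairing_div_vtheta_theta_eq_zero (v : VCoef) (a : Coef)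
    (hv0 : v (0, 0) = 0) (hvreal : vRealCoef v) (hvH1 : vMemSob 1 v)
    (hdivfree : ∀ k : Freq, (k.1 : ℂ) * (v k).1 + (k.2 : ℂ) * (v k).2 = 0)
    (ha0 : MeanZero a) (hareal : RealCoef a) (haH1 : MemSob 1 a) :
    pairing (divV v a) a = 0 := by
  have hW1 : ∀ k : Freq, (1 + (2 * Real.pi * knorm k)^2) ^ (1:ℝ)
      = 1 + (2 * Real.pi * knorm k)^2 := fun k => Real.rpow_one _
  unfold vMemSob at hvH1
  unfold MemSob at haH1
  simp only [hW1] at hvH1 haH1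
  have hv1 : Summable fun k : Freq => (1 + (2 * Real.pi * knorm k)^2) * ‖(v k).1‖ ^ 2 := by
    refine Summable.of_nonneg_of_le (fun k => by positivity) (fun k => ?_) hvH1
    exact mul_le_mul_of_nonneg_left (by nlinarith [sq_nonneg ‖(v k).2‖]) (by positivity)
  have hv2 : Summable fun k : Freq => (1 + (2 * Real.pi * knorm k)^2) * ‖(v k).2‖ ^ 2 := by
    refine Summable.of_nonneg_of_le (fun k => by positivity) (fun k => ?_) hvH1
    exact mul_le_mul_of_nonneg_left (by nlinarith [sq_nonneg ‖(v k).1‖]) (by positivity)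
  have hg1 : Summable fun k : Freq => ‖(k.1 : ℂ) * (starRingEnd ℂ) (a k)‖ ^ 2 := by
    refine Summable.of_nonneg_of_le (fun k => by positivity) (fun k => ?_) haH1
    rw [norm_mul, mul_pow, RCLike.norm_conj, Complex.norm_intCast, sq_abs]
    exact mul_le_mul_of_nonneg_right
      (by nlinarith [aux_W_ge k, sq_nonneg (k.2 : ℝ)]) (by positivity)
  have hg2 : Summable fun k : Freq => ‖(k.2 : ℂ) * (starRingEnd ℂ) (a k)‖ ^ 2 := by
    refine Summable.of_nonneg_of_le (fun k => by positivity) (fun k => ?_) haH1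
    rw [norm_mul, mul_pow, RCLike.norm_conj, Complex.norm_intCast, sq_abs]
    exact mul_le_mul_of_nonneg_right
      (by nlinarith [aux_W_ge k, sq_nonneg (k.1 : ℝ)]) (by positivity)
  have hT1 := aux_trilinear (fun k => (v k).1) a _ hv1 haH1 hg1
  have hT2 := aux_trilinear (fun k => (v k).2) a _ hv2 haH1 hg2
  have hT := hT1.add hT2
  have hsum : ∑' k : Freq, divV v a k * (starRingEnd ℂ) (a k)
      = (2 * Real.pi) * Complex.I * ∑' p : Freq × Freq,
        ((p.1.1 : ℂ) * (starRingEnd ℂ) (a p.1) * ((v p.2).1 * a (p.1 - p.2))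
          + (p.1.2 : ℂ) * (starRingEnd ℂ) (a p.1) * ((v p.2).2 * a (p.1 - p.2))) := by
    rw [hT.tsum_prod, ← tsum_mul_left]
    refine tsum_congr fun k => ?_
    rw [(hT1.prod_factor k).tsum_add (hT2.prod_factor k)]
    dsimp only
    rw [tsum_mul_left, tsum_mul_left]
    unfold divV
    ring
  have hconj : (starRingEnd ℂ) (∑' p : Freq × Freq,
        ((p.1.1 : ℂ) * (starRingEnd ℂ) (a p.1) * ((v p.2).1 * a (p.1 - p.2))
          + (p.1.2 : ℂ) * (starRingEnd ℂ) (a p.1) * ((v p.2).2 * a (p.1 - p.2))))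
      = ∑' p : Freq × Freq,
        ((p.1.1 : ℂ) * (starRingEnd ℂ) (a p.1) * ((v p.2).1 * a (p.1 - p.2))
          + (p.1.2 : ℂ) * (starRingEnd ℂ) (a p.1) * ((v p.2).2 * a (p.1 - p.2))) := by
    rw [Complex.conj_tsum]
    conv_rhs => rw [← auxSwap.tsum_eq]
    refine tsum_congr fun p => ?_
    obtain ⟨k, j⟩ := p
    have hd := hdivfree (-j)
    simp only [auxSwap, Equiv.coe_fn_mk, sub_neg_eq_add, sub_add_cancel, map_add, map_mul,
      Complex.conj_conj, map_intCast, (hvreal j).1, (hvreal j).2, Prod.fst_sub, Prod.snd_sub,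
      Prod.fst_neg, Prod.snd_neg, Int.cast_sub, Int.cast_neg] at hd ⊢
    linear_combination (-(a k) * (starRingEnd ℂ) (a (k - j))) * hd
  unfold pairing
  rw [hsum]
  have him := Complex.conj_eq_iff_im.1 hconj
  simp [Complex.mul_re, him]

end
end

section
/- For 0 < α ≤ 1 and θ₀ ∈ Ḣ¹(Ω), the solution θ^α of the regularized SQG system satisfies the uniform bounds ‖θ^α(t)‖_{L²} ≤ ‖θ₀‖_{H¹} and ‖∇θ^α(t)‖_{L²} ≤ (1/α)‖θ₀‖_{H¹} for all t. -/
open scoped BigOperators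
open Filter

noncomputable section

theorem aux_conserved {ι : Type*} [Countable ι] (p q : ι → ℝ → ℝ)
    (hp : ∀ k t, HasDerivAt (p k) (q k t) t) (hs : ∀ t, Summable fun k => p k t)
    (C s t : ℝ) (hst : s ≤ t)
    (hq : ∀ τ ∈ Set.Icc s t, Summable fun k => |q k τ|)
    (hC : ∀ τ ∈ Set.Icc s t, ∑' k, |q k τ| ≤ C)
    (h0 : ∀ τ ∈ Set.Icc s t, ∑' k, q k τ = 0) :
    ∑' k, p k s = ∑' k, p k t := by
  have hmeas : ∀ k, Measurable (q k) := by
    intro k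
    have : q k = deriv (p k) := by
      funext x; exact (hp k x).deriv.symm
    rw [this]; exact measurable_deriv _
  have hsub : Set.uIoc s t ⊆ Set.Icc s t := by
    rw [Set.uIoc_of_le hst]; exact Set.Ioc_subset_Icc_self
  have hone : ∀ τ ∈ Set.Icc s t, ∀ S : Finset ι, ∑ k ∈ S, |q k τ| ≤ C := fun τ hτ S =>
    ((hq τ hτ).sum_le_tsum S (fun _ _ => abs_nonneg _)).trans (hC τ hτ)
  have hint : ∀ k, IntervalIntegrable (q k) MeasureTheory.volume s t := by
    intro k
    refine (intervalIntegrable_const (c := C)).mono_fun (hmeas k).aestronglyMeasurable ?_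
    refine (MeasureTheory.ae_restrict_mem measurableSet_uIoc).mono ?_
    intro x hx
    have := hone x (hsub hx) {k}
    simp only [Finset.sum_singleton] at this
    change |q k x| ≤ |C|
    exact this.trans (le_abs_self _)
  have hftc : ∀ k, ∫ x in s..t, q k x = p k t - p k s := fun k =>
    intervalIntegral.integral_eq_sub_of_hasDerivAt (fun x _ => hp k x) (hint k)
  have hlim : Tendsto (fun S : Finset ι => ∫ x in s..t, ∑ k ∈ S, q k x) atTop
      (nhds (∫ x in s..t, (0:ℝ))) := by
    refine intervalIntegral.tendsto_integral_filter_of_dominated_convergence (fun _ => C) ?_ ?_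
      intervalIntegrable_const ?_
    · refine Eventually.of_forall fun S => ?_
      exact (Finset.measurable_sum S (fun k _ => hmeas k)).aestronglyMeasurable
    · refine Eventually.of_forall fun S => Eventually.of_forall fun x hx => ?_
      exact (Finset.abs_sum_le_sum_abs _ _).trans (hone x (hsub hx) S)
    · refine Eventually.of_forall fun x hx => ?_
      have := (hq x (hsub hx)).of_abs.hasSum
      rw [h0 x (hsub hx)] at this
      exact this
  have h2 : (fun S : Finset ι => ∫ x in s..t, ∑ k ∈ S, q k x)
      = fun S => ∑ k ∈ S, (p k t - p k s) := by
    funext S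
    rw [intervalIntegral.integral_finsetSum (fun k _ => hint k)]
    exact Finset.sum_congr rfl fun k _ => hftc k
  rw [h2] at hlim
  have h3 := ((hs t).sub (hs s)).hasSum
  have h4 := tendsto_nhds_unique hlim h3
  rw [(hs t).tsum_sub (hs s)] at h4
  simp at h4
  linarith

theorem aux_compact (E : ℝ → ℝ) (s t : ℝ)
    (h : ∀ x ∈ Set.Icc s t, ∃ U ∈ nhds x, BddAbove (E '' U)) : BddAbove (E '' Set.Icc s t) := by
  refine IsCompact.induction_on (p := fun S => BddAbove (E '' S)) isCompact_Icc ?_ ?_ ?_ ?_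
  · simp
  · intro S T hST hT
    exact hT.mono (Set.image_mono hST)
  · intro S T hS hT
    rw [Set.image_union]
    exact hS.union hT
  · intro x hx
    obtain ⟨U, hU, hb⟩ := h x hx
    exact ⟨U, mem_nhdsWithin_of_mem_nhds hU, hb⟩

theorem aux_right (E : ℝ → ℝ)
    (H : ∀ s t, s ≤ t → BddAbove (E '' Set.Icc s t) → E s = E t)
    (F : Set ℝ) (hF : IsClosed F) (hG : ∀ x ∉ F, ∃ U ∈ nhds x, BddAbove (E '' U))
    (n f t : ℝ) (hft : f ≤ t) (hfF : f ∈ F) (hn : ∀ x ∈ F, x ∈ Set.Icc f t → E x ≤ n) :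
    E t ≤ n := by
  have hK : IsCompact (F ∩ Set.Icc f t) := isCompact_Icc.inter_left hF
  obtain ⟨a, ⟨haF, hat⟩, hmax⟩ := hK.exists_isGreatest ⟨f, hfF, le_refl _, hft⟩
  have hconst : ∀ s, a < s → s ≤ t → E s = E t := by
    intro s has hst
    refine H s t hst (aux_compact E s t ?_)
    intro x hx
    refine hG x fun hxF => ?_
    have := hmax ⟨hxF, hat.1.trans (has.le.trans hx.1), hx.2⟩
    linarith [hx.1]
  have hE : E a = E t := by
    refine H a t hat.2 ⟨max (E a) (E t), ?_⟩
    rintro _ ⟨x, hx, rfl⟩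
    rcases hx.1.eq_or_lt with h | h
    · rw [← h]; exact le_max_left _ _
    · rw [hconst x h hx.2]; exact le_max_right _ _
  rw [← hE]
  exact hn a haF hat

theorem aux_baire (E : ℝ → ℝ)
    (H : ∀ s t, s ≤ t → BddAbove (E '' Set.Icc s t) → E s = E t)
    (hlsc : ∀ c : ℝ, IsClosed {x | E x ≤ c}) : ∀ s t, E s = E t := by
  set F : Set ℝ := {x | ¬ ∃ U ∈ nhds x, BddAbove (E '' U)} with hFdef
  have hG : ∀ x ∉ F, ∃ U ∈ nhds x, BddAbove (E '' U) := by
    intro x hx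
    simpa only [hFdef, Set.mem_ofPred_eq, not_not] using hx
  have hF : IsClosed F := by
    rw [← isOpen_compl_iff, isOpen_iff_mem_nhds]
    intro x hx
    obtain ⟨U, hU, hb⟩ := hG x hx
    refine Filter.mem_of_superset (eventually_mem_nhds_iff.mpr hU) ?_
    intro y hy
    simp only [hFdef, Set.mem_compl_iff, Set.mem_ofPred_eq, not_not]
    exact ⟨U, hy, hb⟩
  have hempty : F = ∅ := by
    by_contra hne
    have hne' : F.Nonempty := Set.nonempty_iff_ne_empty.mpr hne
    have : Nonempty F := hne'.to_subtype
    have : CompleteSpace F := hF.completeSpace_coe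
    obtain ⟨n, x, hx⟩ := nonempty_interior_of_iUnion_of_closed
      (f := fun n : ℕ => {x : F | E x ≤ n})
      (fun n => (hlsc n).preimage continuous_subtype_val)
      (by
        ext x
        simp only [Set.mem_iUnion, Set.mem_ofPred_eq, Set.mem_univ, iff_true]
        exact exists_nat_ge _)
    rw [mem_interior_iff_mem_nhds, Metric.mem_nhds_iff] at hx
    obtain ⟨r, hr, hball⟩ := hx
    have hn : ∀ y ∈ F, |y - x| < r → E y ≤ n := by
      intro y hy hyx
      exact hball (show (⟨y, hy⟩ : F) ∈ Metric.ball x r from hyx)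
    refine x.2 ⟨Metric.ball (x:ℝ) r, Metric.ball_mem_nhds _ hr, n, ?_⟩
    rintro _ ⟨t, ht, rfl⟩
    rw [Metric.mem_ball, Real.dist_eq, abs_lt] at ht
    rcases le_total (x:ℝ) t with hxt | hxt
    · refine aux_right E H F hF hG n x t hxt x.2 fun y hy hyI => hn y hy ?_
      rw [abs_lt]; constructor <;> linarith [hyI.1, hyI.2]
    · have := aux_right (fun y => E (-y)) ?_ (Neg.neg ⁻¹' F) (hF.preimage continuous_neg) ?_
        n (-x) (-t) (by linarith) (by simp) ?_
      · simpa using this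
      · intro s u hsu hb
        refine (H (-u) (-s) (by linarith) ?_).symm
        convert hb using 1
        ext z
        constructor
        · rintro ⟨w, hw, rfl⟩
          exact ⟨-w, ⟨by linarith [hw.2], by linarith [hw.1]⟩, by simp⟩
        · rintro ⟨w, hw, rfl⟩
          exact ⟨-w, ⟨by linarith [hw.2], by linarith [hw.1]⟩, by simp⟩
      · intro y hy
        obtain ⟨U, hU, M, hM⟩ := hG (-y) hy
        refine ⟨Neg.neg ⁻¹' U, continuous_neg.continuousAt.preimage_mem_nhds hU, M, ?_⟩
        rintro _ ⟨w, hw, rfl⟩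
        exact hM ⟨-w, hw, rfl⟩
      · intro y hy hyI
        refine hn (-y) hy ?_
        rw [abs_lt]; constructor <;> linarith [hyI.1, hyI.2]
  have key : ∀ s t, s ≤ t → E s = E t := by
    intro s t hst
    refine H s t hst (aux_compact E s t fun x _ => hG x ?_)
    rw [hempty]; exact Set.notMem_empty x
  intro s t
  rcases le_total s t with h | h
  · exact key s t h
  · exact (key t s h).symm

/-- The weight `1 + (2π|k|)²`. -/
def Mw (k : Freq) : ℝ := 1 + (2 * Real.pi * knorm k) ^ 2

theorem knorm_sq (k : Freq) : knorm k ^ 2 = (k.1 : ℝ)^2 + (k.2 : ℝ)^2 := by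
  unfold knorm
  exact Real.sq_sqrt (by positivity)

theorem knorm_nonneg (k : Freq) : 0 ≤ knorm k := Real.sqrt_nonneg _

theorem Mw_pos (k : Freq) : 0 < Mw k := by unfold Mw; positivity

theorem Mw_ge (k : Freq) : 1 + ((k.1 : ℝ)^2 + (k.2 : ℝ)^2) ≤ Mw k := by
  unfold Mw
  rw [mul_pow, knorm_sq]
  have h : (1:ℝ) ≤ (2 * Real.pi)^2 := by nlinarith [Real.pi_gt_three]
  have h2 : 0 ≤ (k.1 : ℝ)^2 + (k.2 : ℝ)^2 := by positivity
  nlinarith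

theorem abs_fst_le (k : Freq) : |(k.1 : ℝ)| ≤ knorm k :=
  Real.abs_le_sqrt (by nlinarith [sq_nonneg (k.2 : ℝ)])

theorem abs_snd_le (k : Freq) : |(k.2 : ℝ)| ≤ knorm k :=
  Real.abs_le_sqrt (by nlinarith [sq_nonneg (k.1 : ℝ)])

theorem summable_int_aux : Summable fun n : ℤ => 1 / (1 + (n : ℝ) ^ 2) := by
  have h1 : Summable fun n : ℤ => 1 / (n : ℝ) ^ 2 := Real.summable_one_div_int_pow.mpr (by norm_num)
  have h2 : Summable fun n : ℤ => if n = 0 then (1:ℝ) else 0 :=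
    (hasSum_ite_eq (0:ℤ) (1:ℝ)).summable
  refine Summable.of_nonneg_of_le (fun n => by positivity) (fun n => ?_) (h1.add h2)
  by_cases hn : n = 0
  · subst hn; simp
  · have : (n:ℝ) ≠ 0 := by exact_mod_cast hn
    have h3 : 0 < (n:ℝ)^2 := by positivity
    simp only [hn, if_false, add_zero]
    exact one_div_le_one_div_of_le h3 (by linarith)

theorem summable_Mw : Summable fun k : Freq => 1 / (Mw k) ^ 2 := by
  have h := summable_int_aux.mul_of_nonneg summable_int_aux (fun n => by positivity)
    (fun n => by positivity)
  refine Summable.of_nonneg_of_le (fun k => by positivity) (fun k => ?_) h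
  rw [div_mul_div_comm, one_mul]
  refine one_div_le_one_div_of_le (by positivity) ?_
  have h1 := Mw_ge k
  have ha := sq_nonneg (k.1 : ℝ)
  have hb := sq_nonneg (k.2 : ℝ)
  nlinarith

theorem vel_fst_le (a : Coef) (j : Freq) : ‖(vel a j).1‖ ≤ ‖a j‖ := by
  unfold vel
  split_ifs with h
  · simp
  · have h2 := abs_snd_le j
    simp only [norm_mul, norm_div, Complex.norm_I, norm_neg, one_mul, Complex.norm_intCast,
      Complex.norm_real, Real.norm_eq_abs, abs_of_nonneg (knorm_nonneg j)]
    exact mul_le_of_le_one_left (norm_nonneg _) (div_le_one_of_le₀ h2 (knorm_nonneg j))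

theorem vel_snd_le (a : Coef) (j : Freq) : ‖(vel a j).2‖ ≤ ‖a j‖ := by
  unfold vel
  split_ifs with h
  · simp
  · have h2 := abs_fst_le j
    simp only [norm_mul, norm_div, Complex.norm_I, norm_neg, one_mul, Complex.norm_intCast,
      Complex.norm_real, Real.norm_eq_abs, abs_of_nonneg (knorm_nonneg j)]
    exact mul_le_of_le_one_left (norm_nonneg _) (div_le_one_of_le₀ h2 (knorm_nonneg j))

theorem vel_div_free (a : Coef) (j : Freq) :
    (j.1 : ℂ) * (vel a j).1 + (j.2 : ℂ) * (vel a j).2 = 0 := by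
  unfold vel
  split_ifs with h
  · simp
  · simp only; ring

/-- The trilinear term. -/
def Tt (a : Coef) (x : Freq × Freq) : ℂ :=
  (starRingEnd ℂ) (a x.1) *
    (((x.1.1 : ℂ) * (vel a x.2).1 + (x.1.2 : ℂ) * (vel a x.2).2) * a (x.1 - x.2))

theorem ineq_aux (κ m A B D p r : ℝ) (hκ : κ ^ 2 ≤ m) (hp : 0 < p) (hr : 0 < r) :
    A * ((κ * B + κ * B) * D) ≤
      (m * A ^ 2) * (1 / p ^ 2) + (m * A ^ 2) * (1 / r ^ 2) + (p * B ^ 2) * (r * D ^ 2) := by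
  have h1 : A * ((κ * B + κ * B) * D) ≤ (κ * A) ^ 2 * (1 / (p * r)) + (p * r) * (B * D) ^ 2 := by
    have hpr : 0 < p * r := by positivity
    have : 0 ≤ (1 / (p * r)) * (κ * A - (p * r) * (B * D)) ^ 2 := by positivity
    have e : (1 / (p * r)) * (κ * A - (p * r) * (B * D)) ^ 2 =
      (κ * A) ^ 2 * (1 / (p * r)) + (p * r) * (B * D) ^ 2 - A * ((κ * B + κ * B) * D) := by
      field_simp
      ring
    linarith
  have h2 : 1 / (p * r) ≤ 1 / p ^ 2 + 1 / r ^ 2 := by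
    have e1 : 1 / (p * r) = (1 / p) * (1 / r) := by field_simp
    have e2 : 1 / p ^ 2 = (1 / p) ^ 2 := by field_simp
    have e3 : 1 / r ^ 2 = (1 / r) ^ 2 := by field_simp
    rw [e1, e2, e3]
    nlinarith [sq_nonneg (1 / p - 1 / r), sq_nonneg (1 / p), sq_nonneg (1 / r)]
  have h3 : (κ * A) ^ 2 ≤ m * A ^ 2 := by
    rw [mul_pow]; exact mul_le_mul_of_nonneg_right hκ (sq_nonneg _)
  have h4 : (κ * A) ^ 2 * (1 / (p * r)) ≤ (m * A ^ 2) * (1 / p ^ 2 + 1 / r ^ 2) := by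
    apply mul_le_mul h3 h2 (by positivity)
    exact (sq_nonneg _).trans h3
  nlinarith

theorem Tt_le (a : Coef) (x : Freq × Freq) :
    ‖Tt a x‖ ≤ (Mw x.1 * ‖a x.1‖ ^ 2) * (1 / Mw x.2 ^ 2)
      + (Mw x.1 * ‖a x.1‖ ^ 2) * (1 / Mw (x.1 - x.2) ^ 2)
      + (Mw x.2 * ‖a x.2‖ ^ 2) * (Mw (x.1 - x.2) * ‖a (x.1 - x.2)‖ ^ 2) := by
  refine le_trans ?_ (ineq_aux (knorm x.1) (Mw x.1) ‖a x.1‖ ‖a x.2‖ ‖a (x.1 - x.2)‖ (Mw x.2)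
    (Mw (x.1 - x.2)) ?_ (Mw_pos _) (Mw_pos _))
  · unfold Tt
    rw [norm_mul, norm_mul, RCLike.norm_conj]
    gcongr
    refine (norm_add_le _ _).trans ?_
    rw [norm_mul, norm_mul, Complex.norm_intCast, Complex.norm_intCast]
    exact add_le_add
      (mul_le_mul (abs_fst_le _) (vel_fst_le _ _) (norm_nonneg _) (knorm_nonneg _))
      (mul_le_mul (abs_snd_le _) (vel_snd_le _ _) (norm_nonneg _) (knorm_nonneg _))
  · have := Mw_ge x.1
    rw [knorm_sq]; linarith

/-- The shear `(k, j) ↦ (k, k - j)`. -/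
def shear : Freq × Freq ≃ Freq × Freq where
  toFun x := (x.1, x.1 - x.2)
  invFun x := (x.1, x.1 - x.2)
  left_inv x := by simp
  right_inv x := by simp

/-- The shear `(k, j) ↦ (j, k - j)`. -/
def shear2 : Freq × Freq ≃ Freq × Freq where
  toFun x := (x.2, x.1 - x.2)
  invFun x := (x.1 + x.2, x.1)
  left_inv x := by simp
  right_inv x := by simp

/-- The involution `(k, j) ↦ (j - k, j)`. -/
def flip3 : Freq × Freq ≃ Freq × Freq where
  toFun x := (x.2 - x.1, x.2)
  invFun x := (x.2 - x.1, x.2)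
  left_inv x := by simp
  right_inv x := by simp

theorem hasSum_shear (b c : Freq → ℝ) (hb : Summable b) (hc : Summable c)
    (hn : ∀ k, 0 ≤ b k) (hn2 : ∀ k, 0 ≤ c k) :
    HasSum (fun x : Freq × Freq => b x.1 * c x.2 + b x.1 * c (x.1 - x.2) + b x.2 * b (x.1 - x.2))
      ((∑' k, b k) * (∑' k, c k) + (∑' k, b k) * (∑' k, c k) + (∑' k, b k) * (∑' k, b k)) := by
  have s1 : HasSum (fun x : Freq × Freq => b x.1 * c x.2) _ :=
    hb.hasSum.mul hc.hasSum (hb.mul_of_nonneg hc hn hn2)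
  have s2 : HasSum (fun x : Freq × Freq => b x.1 * b x.2) _ :=
    hb.hasSum.mul hb.hasSum (hb.mul_of_nonneg hb hn hn)
  have s3 : HasSum (fun x : Freq × Freq => b x.1 * c (x.1 - x.2)) _ := (shear.hasSum_iff).mpr s1
  have s4 : HasSum (fun x : Freq × Freq => b x.2 * b (x.1 - x.2)) _ := (shear2.hasSum_iff).mpr s2
  exact (s1.add s3).add s4

theorem hasSum_bound (a : Coef) (h : Summable fun k => Mw k * ‖a k‖ ^ 2) :
    HasSum (fun x : Freq × Freq => (Mw x.1 * ‖a x.1‖ ^ 2) * (1 / Mw x.2 ^ 2)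
      + (Mw x.1 * ‖a x.1‖ ^ 2) * (1 / Mw (x.1 - x.2) ^ 2)
      + (Mw x.2 * ‖a x.2‖ ^ 2) * (Mw (x.1 - x.2) * ‖a (x.1 - x.2)‖ ^ 2))
      ((∑' k, Mw k * ‖a k‖ ^ 2) * (∑' k : Freq, 1 / Mw k ^ 2)
        + (∑' k, Mw k * ‖a k‖ ^ 2) * (∑' k : Freq, 1 / Mw k ^ 2)
        + (∑' k, Mw k * ‖a k‖ ^ 2) * (∑' k, Mw k * ‖a k‖ ^ 2)) := by
  have hn : ∀ k, 0 ≤ Mw k * ‖a k‖ ^ 2 := fun k => mul_nonneg (Mw_pos k).le (sq_nonneg _)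
  have hn2 : ∀ k : Freq, 0 ≤ 1 / Mw k ^ 2 := fun k => by positivity
  exact hasSum_shear (fun k => Mw k * ‖a k‖ ^ 2) (fun k => 1 / Mw k ^ 2) h summable_Mw hn hn2

theorem summable_Tt (a : Coef) (h : Summable fun k => Mw k * ‖a k‖ ^ 2) :
    Summable fun x => ‖Tt a x‖ :=
  Summable.of_nonneg_of_le (fun _ => norm_nonneg _) (Tt_le a) (hasSum_bound a h).summable

theorem tsum_Tt_zero (a : Coef) (hr : RealCoef a) : ∑' x, Tt a x = 0 := by
  have h1 : ∑' x, Tt a (flip3 x) = ∑' x, Tt a x := flip3.tsum_eq _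
  have h2 : ∀ x, Tt a (flip3 x) = - Tt a x := by
    rintro ⟨k, j⟩
    have e1 : (starRingEnd ℂ) (a (j - k)) = a (k - j) := by rw [← hr, neg_sub]
    have e2 : a (j - k - j) = (starRingEnd ℂ) (a k) := by
      rw [← hr]; congr 1; abel
    have e3 := vel_div_free a j
    simp only [Tt, flip3, Equiv.coe_fn_mk]
    rw [e1, e2]
    simp only [Prod.fst_sub, Prod.snd_sub, Int.cast_sub]
    linear_combination (a (k - j) * (starRingEnd ℂ) (a k)) * e3
  simp only [h2] at h1
  rw [tsum_neg] at h1
  have h3 : (2:ℂ) * ∑' x, Tt a x = 0 := by linear_combination -h1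
  simpa using h3

theorem summable_conv (a : Coef) (h : Summable fun k => Mw k * ‖a k‖ ^ 2) (u : Freq → ℂ)
    (hu : ∀ j, ‖u j‖ ≤ ‖a j‖) (k : Freq) : Summable fun j => u j * a (k - j) := by
  have h1 : Summable fun j => ‖a j‖ ^ 2 := by
    refine Summable.of_nonneg_of_le (fun _ => sq_nonneg _) (fun j => ?_) h
    have := Mw_ge j
    refine le_mul_of_one_le_left (sq_nonneg _) ?_
    nlinarith [sq_nonneg (j.1 : ℝ), sq_nonneg (j.2 : ℝ)]
  have h2 : Summable fun j => ‖a (k - j)‖ ^ 2 :=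
    ((Equiv.subLeft k).summable_iff (f := fun j => ‖a j‖ ^ 2)).mpr h1
  refine Summable.of_norm_bounded (h1.add h2) fun j => ?_
  rw [norm_mul]
  have := mul_le_mul_of_nonneg_right (hu j) (norm_nonneg (a (k - j)))
  nlinarith [sq_nonneg (‖a j‖ - ‖a (k - j)‖), sq_nonneg (‖a j‖), sq_nonneg (‖a (k - j)‖)]

theorem conj_mul_divV (a : Coef) (h : Summable fun k => Mw k * ‖a k‖ ^ 2) (k : Freq) :
    (starRingEnd ℂ) (a k) * divV (vel a) a k
      = (2 * Real.pi) * Complex.I * ∑' j, Tt a (k, j) := by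
  have s1 := summable_conv a h (fun j => (vel a j).1) (vel_fst_le a) k
  have s2 := summable_conv a h (fun j => (vel a j).2) (vel_snd_le a) k
  unfold divV
  rw [← tsum_mul_left, ← tsum_mul_left, ← (s1.mul_left _).tsum_add (s2.mul_left _)]
  rw [mul_left_comm, ← tsum_mul_left]
  congr 1
  refine tsum_congr fun j => ?_
  simp only [Tt]
  ring

theorem flux_facts (a : Coef) (h : Summable fun k => Mw k * ‖a k‖ ^ 2) (hr : RealCoef a) :
    Summable (fun k => ‖(starRingEnd ℂ) (a k) * divV (vel a) a k‖) ∧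
    ∑' k, ‖(starRingEnd ℂ) (a k) * divV (vel a) a k‖ ≤
      2 * Real.pi * ((∑' k, Mw k * ‖a k‖ ^ 2) * (∑' k : Freq, 1 / Mw k ^ 2)
        + (∑' k, Mw k * ‖a k‖ ^ 2) * (∑' k : Freq, 1 / Mw k ^ 2)
        + (∑' k, Mw k * ‖a k‖ ^ 2) * (∑' k, Mw k * ‖a k‖ ^ 2)) ∧
    ∑' k, (starRingEnd ℂ) (a k) * divV (vel a) a k = 0 := by
  have hT := summable_Tt a h
  have hle : ∀ k, ‖(starRingEnd ℂ) (a k) * divV (vel a) a k‖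
      ≤ 2 * Real.pi * ∑' j, ‖Tt a (k, j)‖ := by
    intro k
    rw [conj_mul_divV a h, norm_mul]
    have e : ‖(2 * (Real.pi : ℂ)) * Complex.I‖ = 2 * Real.pi := by
      simp [abs_of_pos Real.pi_pos]
    rw [e]
    refine mul_le_mul_of_nonneg_left ?_ (by positivity)
    exact norm_tsum_le_tsum_norm (hT.prod_factor k)
  have hS : Summable fun k => 2 * Real.pi * ∑' j, ‖Tt a (k, j)‖ := hT.prod.mul_left _
  have hs := Summable.of_nonneg_of_le (fun _ => norm_nonneg _) hle hS
  refine ⟨hs, ?_, ?_⟩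
  · refine (hs.tsum_le_tsum hle hS).trans ?_
    rw [tsum_mul_left, ← hT.tsum_prod]
    refine mul_le_mul_of_nonneg_left ?_ (by positivity)
    rw [← (hasSum_bound a h).tsum_eq]
    exact hT.tsum_le_tsum (Tt_le a) (hasSum_bound a h).summable
  · simp only [conj_mul_divV a h]
    rw [tsum_mul_left, ← hT.of_norm.tsum_prod, tsum_Tt_zero a hr, mul_zero]

theorem energy_deriv (α : ℝ) (θ : ℝ → Coef) (hsol : SolvesRSQG α θ) (k : Freq) (t : ℝ) :
    HasDerivAt (fun s => (1 + α ^ 2 * (2 * Real.pi * knorm k) ^ 2) * ‖θ s k‖ ^ 2)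
      (-2 * ((starRingEnd ℂ) (θ t k) * divV (vel (θ t)) (θ t) k).re) t := by
  set m : ℝ := 1 + α ^ 2 * (2 * Real.pi * knorm k) ^ 2 with hm
  have hmpos : 0 < m := by positivity
  have h1 := ((hsol.2 k t).norm_sq).mul_const (1 / m)
  have e : (fun s => ‖Jop α (θ s) k‖ ^ 2 * (1 / m)) = fun s => m * ‖θ s k‖ ^ 2 := by
    funext s
    simp only [Jop]
    rw [← hm, norm_mul, Complex.norm_real, Real.norm_eq_abs, abs_of_pos hmpos]
    field_simp
  rw [e] at h1
  refine h1.congr_deriv (Eq.symm ?_)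
  simp only [Complex.inner, Jop]
  rw [← hm, map_mul, Complex.conj_ofReal]
  have e2 : ∀ z w : ℂ, ((m : ℂ) * z * -w).re = -(m * (z * w).re) := by
    intro z w
    rw [mul_assoc, Complex.re_ofReal_mul]
    simp
    ring
  rw [mul_comm (-divV _ _ _), e2]
  field_simp

theorem rsqg_energy (α : ℝ) (hα0 : 0 < α) (hα1 : α ≤ 1)
    (θ : ℝ → Coef) (hsol : SolvesRSQG α θ) (hreg : ∀ t : ℝ, Summable fun k => Mw k * ‖θ t k‖ ^ 2) :
    ∀ s t, ∑' k, (1 + α ^ 2 * (2 * Real.pi * knorm k) ^ 2) * ‖θ s k‖ ^ 2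
      = ∑' k, (1 + α ^ 2 * (2 * Real.pi * knorm k) ^ 2) * ‖θ t k‖ ^ 2 := by
  have hα2 : α ^ 2 ≤ 1 := by nlinarith
  have hsum : ∀ t, Summable fun k => (1 + α ^ 2 * (2 * Real.pi * knorm k) ^ 2) * ‖θ t k‖ ^ 2 := by
    intro t
    refine Summable.of_nonneg_of_le (fun k => by positivity) (fun k => ?_) (hreg t)
    refine mul_le_mul_of_nonneg_right ?_ (sq_nonneg _)
    unfold Mw
    nlinarith [sq_nonneg (2 * Real.pi * knorm k)]
  have hB : ∀ t, ∑' k, Mw k * ‖θ t k‖ ^ 2 ≤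
      1 / α ^ 2 * ∑' k, (1 + α ^ 2 * (2 * Real.pi * knorm k) ^ 2) * ‖θ t k‖ ^ 2 := by
    intro t
    rw [← tsum_mul_left]
    refine (hreg t).tsum_le_tsum (fun k => ?_) ((hsum t).mul_left _)
    rw [← mul_assoc]
    refine mul_le_mul_of_nonneg_right ?_ (sq_nonneg _)
    unfold Mw
    have : (1:ℝ) ≤ 1 / α ^ 2 := one_le_one_div (by positivity) hα2
    have e : 1 / α ^ 2 * (1 + α ^ 2 * (2 * Real.pi * knorm k) ^ 2)
      = 1 / α ^ 2 + (2 * Real.pi * knorm k) ^ 2 := by field_simp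
    rw [e]; linarith
  refine aux_baire (fun t => ∑' k, (1 + α ^ 2 * (2 * Real.pi * knorm k) ^ 2) * ‖θ t k‖ ^ 2) ?_ ?_
  · rintro s t hst ⟨M, hM⟩
    set N : ℝ := 1 / α ^ 2 * M
    have hBN : ∀ τ ∈ Set.Icc s t, ∑' k, Mw k * ‖θ τ k‖ ^ 2 ≤ N := fun τ hτ =>
      (hB τ).trans (mul_le_mul_of_nonneg_left (hM ⟨τ, hτ, rfl⟩) (by positivity))
    have hB0 : ∀ τ, 0 ≤ ∑' k, Mw k * ‖θ τ k‖ ^ 2 := fun τ =>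
      tsum_nonneg fun k => mul_nonneg (Mw_pos k).le (sq_nonneg _)
    have hC0 : 0 ≤ ∑' k : Freq, 1 / Mw k ^ 2 := tsum_nonneg fun k => by positivity
    have hle : ∀ τ k, |-2 * ((starRingEnd ℂ) (θ τ k) * divV (vel (θ τ)) (θ τ) k).re|
        ≤ 2 * ‖(starRingEnd ℂ) (θ τ k) * divV (vel (θ τ)) (θ τ) k‖ := by
      intro τ k
      rw [abs_mul, abs_neg, abs_two]
      exact mul_le_mul_of_nonneg_left (Complex.abs_re_le_norm _) (by norm_num)
    have hq : ∀ τ, Summable fun k =>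
        |-2 * ((starRingEnd ℂ) (θ τ k) * divV (vel (θ τ)) (θ τ) k).re| := fun τ =>
      Summable.of_nonneg_of_le (fun _ => abs_nonneg _) (hle τ)
        ((flux_facts (θ τ) (hreg τ) (hsol.1 τ).2).1.mul_left 2)
    refine aux_conserved
      (fun k s => (1 + α ^ 2 * (2 * Real.pi * knorm k) ^ 2) * ‖θ s k‖ ^ 2)
      (fun k t => -2 * ((starRingEnd ℂ) (θ t k) * divV (vel (θ t)) (θ t) k).re)
      (energy_deriv α θ hsol) hsum
      (2 * (2 * Real.pi * (N * (∑' k : Freq, 1 / Mw k ^ 2)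
        + N * (∑' k : Freq, 1 / Mw k ^ 2) + N * N))) s t hst (fun τ _ => hq τ) ?_ ?_
    · intro τ hτ
      have hf := flux_facts (θ τ) (hreg τ) (hsol.1 τ).2
      refine ((hq τ).tsum_le_tsum (hle τ) (hf.1.mul_left 2)).trans ?_
      rw [tsum_mul_left]
      refine mul_le_mul_of_nonneg_left (hf.2.1.trans ?_) (by norm_num)
      have h1 := hBN τ hτ
      have h0 := hB0 τ
      have hN0 := h0.trans h1
      gcongr
    · intro τ hτ
      have hf := flux_facts (θ τ) (hreg τ) (hsol.1 τ).2
      rw [tsum_mul_left, ← Complex.re_tsum hf.1.of_norm, hf.2.2]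
      simp
  · intro c
    have e : {t : ℝ | ∑' k, (1 + α ^ 2 * (2 * Real.pi * knorm k) ^ 2) * ‖θ t k‖ ^ 2 ≤ c}
        = ⋂ S : Finset Freq,
          {t : ℝ | ∑ k ∈ S, (1 + α ^ 2 * (2 * Real.pi * knorm k) ^ 2) * ‖θ t k‖ ^ 2 ≤ c} := by
      ext t
      simp only [Set.mem_ofPred_eq, Set.mem_iInter]
      constructor
      · intro h S
        exact ((hsum t).sum_le_tsum S (fun k _ => by positivity)).trans h
      · intro h
        exact (hsum t).tsum_le_of_sum_le h
    rw [e]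
    refine isClosed_iInter fun S => isClosed_le (continuous_finsetSum _ fun k _ => ?_)
      continuous_const
    exact continuous_iff_continuousAt.mpr fun t => (energy_deriv α θ hsol k t).continuousAt

/-- For `0 < α ≤ 1` and `θ₀ ∈ Ḣ¹(Ω)`, the regularized solution satisfies
`‖θ^α(t)‖_{L²} ≤ ‖θ₀‖_{H¹}` and `‖∇θ^α(t)‖_{L²} ≤ (1/α)‖θ₀‖_{H¹}` for all `t`. -/
theorem rsqg_uniform_bounds (α : ℝ) (hα0 : 0 < α) (hα1 : α ≤ 1)
    (θ₀ : Coef) (h0mean : MeanZero θ₀) (hH1 : MemSob 1 θ₀)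
    (θ : ℝ → Coef) (hinit : θ 0 = θ₀)
    (hsol : SolvesRSQG α θ) (hreg : ∀ t : ℝ, MemSob 1 (θ t)) :
    ∀ t : ℝ, L2n (θ t) ≤ Sob 1 θ₀ ∧ hSob 1 (θ t) ≤ (1 / α) * Sob 1 θ₀ := by
  have hMS : ∀ a : Coef, MemSob 1 a → Summable fun k => Mw k * ‖a k‖ ^ 2 := by
    intro a ha
    simpa only [MemSob, Real.rpow_one, Mw] using ha
  have hreg' := fun t => hMS _ (hreg t)
  have hα2 : α ^ 2 ≤ 1 := by nlinarith
  have hsum : ∀ t, Summable fun k => (1 + α ^ 2 * (2 * Real.pi * knorm k) ^ 2) * ‖θ t k‖ ^ 2 := by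
    intro t
    refine Summable.of_nonneg_of_le (fun k => by positivity) (fun k => ?_) (hreg' t)
    refine mul_le_mul_of_nonneg_right ?_ (sq_nonneg _)
    unfold Mw
    nlinarith [sq_nonneg (2 * Real.pi * knorm k)]
  intro t
  have hE : ∑' k, (1 + α ^ 2 * (2 * Real.pi * knorm k) ^ 2) * ‖θ t k‖ ^ 2 ≤ SobSq 1 θ₀ := by
    rw [rsqg_energy α hα0 hα1 θ hsol hreg' t 0]
    simp only [SobSq, Real.rpow_one]
    rw [← hinit]
    refine (hsum 0).tsum_le_tsum (fun k => ?_) (hreg' 0)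
    refine mul_le_mul_of_nonneg_right ?_ (sq_nonneg _)
    nlinarith [sq_nonneg (2 * Real.pi * knorm k)]
  have hw : ∀ k, wgt 1 k = (2 * Real.pi * knorm k) ^ 2 := by
    intro k
    unfold wgt
    rw [mul_one]
    exact Real.rpow_two _
  constructor
  · refine Real.sqrt_le_sqrt (le_trans ?_ hE)
    have hle : ∀ k, ‖θ t k‖ ^ 2 ≤ (1 + α ^ 2 * (2 * Real.pi * knorm k) ^ 2) * ‖θ t k‖ ^ 2 :=
      fun k => le_mul_of_one_le_left (sq_nonneg _) (le_add_of_nonneg_right (by positivity))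
    exact (Summable.of_nonneg_of_le (fun _ => sq_nonneg _) hle (hsum t)).tsum_le_tsum hle (hsum t)
  · have hle : ∀ k, wgt 1 k * ‖θ t k‖ ^ 2 ≤
        (1 / α) ^ 2 * ((1 + α ^ 2 * (2 * Real.pi * knorm k) ^ 2) * ‖θ t k‖ ^ 2) := by
      intro k
      rw [hw, ← mul_assoc]
      refine mul_le_mul_of_nonneg_right ?_ (sq_nonneg _)
      have e : (1 / α) ^ 2 * (1 + α ^ 2 * (2 * Real.pi * knorm k) ^ 2)
        = (1 / α) ^ 2 + (2 * Real.pi * knorm k) ^ 2 := by field_simp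
      rw [e]
      exact le_add_of_nonneg_left (by positivity)
    have hs2 := (hsum t).mul_left ((1 / α) ^ 2)
    have hs1 : Summable fun k => wgt 1 k * ‖θ t k‖ ^ 2 :=
      Summable.of_nonneg_of_le (fun k => by rw [hw]; positivity) hle hs2
    have h1 : hSobSq 1 (θ t) ≤ (1 / α) ^ 2 * SobSq 1 θ₀ := by
      refine (hs1.tsum_le_tsum hle hs2).trans ?_
      rw [tsum_mul_left]
      exact mul_le_mul_of_nonneg_left hE (by positivity)
    unfold hSob Sob
    refine (Real.sqrt_le_sqrt h1).trans ?_
    rw [Real.sqrt_mul (by positivity), Real.sqrt_sq (by positivity)]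

end
end
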